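/- arXiv:2104.06222 — 4 statements merged into one kernel-verified Lean document; each statement's English description precedes it below -/
import Mathlib

section
/- The average number of terms in minimal double-base representations is Ω(n / log n): there exist a constant c > 0 and a natural number N such that for all n ≥ N, (1/2^n) · Σ_{m=0}^{2^n − 1} k*(m) ≥ c · n / log₂ n. -/
/-- Minimal number of terms in a double-base representation of `m`:
the least `k` such that `m` is a sum of `k` terms of the form `2^x * 3^y`. -/
noncomputable def dbCost (m : ℕ) : ℕ :=
  sInf {k : ℕ | ∃ f : Fin k → ℕ × ℕ, ∑ i, 2 ^ (f i).1 * 3 ^ (f i).2 = m}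

open scoped Pointwise in
/-- The numbers below `2 ^ n` with a representation of at most `K` terms number at most
`(n ^ 2 + 1) ^ K`. -/
theorem card_dbCost_le (n K : ℕ) :
    {m ∈ Finset.range (2 ^ n) | dbCost m ≤ K}.card ≤ (n ^ 2 + 1) ^ K := by
  set A : Finset ℕ := insert 0
    ((Finset.range n ×ˢ Finset.range n).image fun p => 2 ^ p.1 * 3 ^ p.2) with hA
  have hAcard : A.card ≤ n ^ 2 + 1 := by
    refine (Finset.card_insert_le _ _).trans (Nat.succ_le_succ ?_)
    refine Finset.card_image_le.trans ?_
    simp [sq]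
  refine (Finset.card_le_card ?_).trans
    ((Finset.card_nsmul_le (s := A) (n := K)).trans (Nat.pow_le_pow_left hAcard K))
  intro m hm
  rw [Finset.mem_filter, Finset.mem_range] at hm
  obtain ⟨hmn, hK⟩ := hm
  have hmem : dbCost m ∈
      {k : ℕ | ∃ f : Fin k → ℕ × ℕ, ∑ i, 2 ^ (f i).1 * 3 ^ (f i).2 = m} :=
    Nat.sInf_mem ⟨m, fun _ => (0, 0), by simp⟩
  obtain ⟨f, hf⟩ := hmem
  refine Finset.nsmul_subset_nsmul_right (by simp [hA]) hK ?_
  rw [Finset.mem_nsmul]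
  refine ⟨fun i => ⟨2 ^ (f i).1 * 3 ^ (f i).2, ?_⟩, by rw [List.sum_ofFn]; exact hf⟩
  have hle : 2 ^ (f i).1 * 3 ^ (f i).2 < 2 ^ n := lt_of_le_of_lt
    (hf ▸ Finset.single_le_sum (f := fun i => 2 ^ (f i).1 * 3 ^ (f i).2)
      (fun _ _ => Nat.zero_le _) (Finset.mem_univ i)) hmn
  refine Finset.mem_insert_of_mem (Finset.mem_image_of_mem _ (a := f i) ?_)
  rw [Finset.mem_product, Finset.mem_range, Finset.mem_range]
  constructor
  · exact (Nat.pow_lt_pow_iff_right one_lt_two).1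
      (lt_of_le_of_lt (Nat.le_mul_of_pos_right _ (by positivity)) hle)
  · refine (Nat.pow_lt_pow_iff_right one_lt_two).1 (lt_of_le_of_lt ?_ hle)
    exact (Nat.pow_le_pow_left (by norm_num) _).trans
      (Nat.le_mul_of_pos_left _ (by positivity))

/-- If `K ≤ n / (6 log₂ n)`, then `(n ^ 2 + 1) ^ K` is at most half of `2 ^ n`. -/
theorem sq_add_one_pow_le {n K : ℕ} (hn : 2 ≤ n) (hK : (K : ℝ) ≤ n / (6 * Real.logb 2 n)) :
    ((n : ℝ) ^ 2 + 1) ^ K ≤ 2 ^ n / 2 := by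
  have hn' : (2 : ℝ) ≤ n := by exact_mod_cast hn
  have hlog : 0 < Real.logb 2 n := Real.logb_pos one_lt_two (by linarith)
  rw [le_div_iff₀ (by positivity)] at hK
  calc ((n : ℝ) ^ 2 + 1) ^ K ≤ ((n : ℝ) ^ 3) ^ K := by
        gcongr
        nlinarith [sq_nonneg (n : ℝ)]
    _ = (2 : ℝ) ^ (Real.logb 2 n * (3 * K : ℕ)) := by
        rw [Real.rpow_mul two_pos.le, Real.rpow_logb two_pos (by norm_num) (by linarith),
          Real.rpow_natCast, pow_mul]
    _ ≤ (2 : ℝ) ^ ((n : ℝ) - 1) := by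
        refine Real.rpow_le_rpow_of_exponent_le one_le_two ?_
        push_cast
        linarith
    _ = 2 ^ n / 2 := by
        rw [Real.rpow_sub two_pos, Real.rpow_natCast, Real.rpow_one]

/-- The average number of terms in minimal double-base representations
is `Ω(n / log₂ n)`. -/
theorem average_dbCost_lower_bound :
    ∃ c : ℝ, 0 < c ∧ ∃ N : ℕ, ∀ n : ℕ, N ≤ n →
      (∑ m ∈ Finset.range (2 ^ n), (dbCost m : ℝ)) / 2 ^ n ≥ c * n / Real.logb 2 n := by
  refine ⟨1 / 12, by norm_num, 2, fun n hn => ?_⟩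
  have hlog : 0 < Real.logb 2 n :=
    Real.logb_pos one_lt_two (by exact_mod_cast hn)
  set t : ℝ := n / (6 * Real.logb 2 n) with ht
  have ht0 : 0 ≤ t := by positivity
  have hfew : (({m ∈ Finset.range (2 ^ n) | dbCost m ≤ ⌊t⌋₊}.card : ℕ) : ℝ) ≤ 2 ^ n / 2 :=
    (by exact_mod_cast card_dbCost_le n ⌊t⌋₊ :
      (({m ∈ Finset.range (2 ^ n) | dbCost m ≤ ⌊t⌋₊}.card : ℕ) : ℝ) ≤
        ((n : ℝ) ^ 2 + 1) ^ ⌊t⌋₊).trans (sq_add_one_pow_le hn (Nat.floor_le ht0))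
  have hsplit := Finset.card_filter_add_card_filter_not (s := Finset.range (2 ^ n))
    (fun m => dbCost m ≤ ⌊t⌋₊)
  rw [Finset.card_range] at hsplit
  have hsplit' : (({m ∈ Finset.range (2 ^ n) | dbCost m ≤ ⌊t⌋₊}.card : ℕ) : ℝ) +
      ({m ∈ Finset.range (2 ^ n) | ¬ dbCost m ≤ ⌊t⌋₊}.card : ℕ) = 2 ^ n := by
    exact_mod_cast hsplit
  rw [ge_iff_le, le_div_iff₀ (by positivity)]
  calc 1 / 12 * n / Real.logb 2 n * 2 ^ n = 2 ^ n / 2 * t := by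
        rw [ht]
        field_simp
        norm_num
    _ ≤ ({m ∈ Finset.range (2 ^ n) | ¬ dbCost m ≤ ⌊t⌋₊}.card : ℕ) * t := by
        gcongr
        linarith
    _ ≤ ∑ m ∈ Finset.range (2 ^ n) with ¬ dbCost m ≤ ⌊t⌋₊, (dbCost m : ℝ) := by
        rw [← nsmul_eq_mul]
        refine Finset.card_nsmul_le_sum _ _ _ fun m hm => ?_
        exact (Nat.lt_of_floor_lt (not_le.1 (Finset.mem_filter.1 hm).2)).le
    _ ≤ ∑ m ∈ Finset.range (2 ^ n), (dbCost m : ℝ) :=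
        Finset.sum_le_sum_of_subset_of_nonneg (Finset.filter_subset _ _)
          fun _ _ _ => Nat.cast_nonneg _
end

section
/- For every integer n ≥ 2, writing L = ⌈log₂(n+1)⌉ and A*(n) = (1/2^n) · Σ_{m=0}^{2^n − 1} k*(m), one has the explicit inequality (2·A*(n) + 1) · L ≥ n; equivalently, Σ_{m=0}^{2^n − 1} k*(m) ≥ 2^n · (n − L) / (2L). -/
/-- The minimal number of terms is attained. -/
theorem exists_dbCost_representation (m : ℕ) :
    ∃ f : Fin (dbCost m) → ℕ × ℕ, ∑ i, 2 ^ (f i).1 * 3 ^ (f i).2 = m :=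
  Nat.sInf_mem (s := {k : ℕ | ∃ f : Fin k → ℕ × ℕ, ∑ i, 2 ^ (f i).1 * 3 ^ (f i).2 = m})
    ⟨m, fun _ => (0, 0), by simp⟩

theorem exponents_lt_of_two_pow_mul_three_pow_lt {n x y : ℕ} (h : 2 ^ x * 3 ^ y < 2 ^ n) :
    x < n ∧ y < n := by
  have hx : 2 ^ x ≤ 2 ^ x * 3 ^ y := Nat.le_mul_of_pos_right _ (by positivity)
  have hy : 3 ^ y ≤ 2 ^ x * 3 ^ y := Nat.le_mul_of_pos_left _ (by positivity)
  have h23 : 2 ^ y ≤ 3 ^ y := Nat.pow_le_pow_left (by norm_num) y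
  exact ⟨(Nat.pow_lt_pow_iff_right (by norm_num)).mp (hx.trans_lt h),
    (Nat.pow_lt_pow_iff_right (by norm_num)).mp ((h23.trans hy).trans_lt h)⟩

theorem card_filter_dbCost_eq_le (n k : ℕ) :
    ((Finset.range (2 ^ n)).filter fun m => dbCost m = k).card ≤ (n ^ 2) ^ k := by
  let val : (Fin k → Fin n × Fin n) → ℕ := fun f => ∑ i, 2 ^ (f i).1.val * 3 ^ (f i).2.val
  have hsub : ((Finset.range (2 ^ n)).filter fun m => dbCost m = k) ⊆
      Finset.univ.image val := by
    intro m hm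
    obtain ⟨hlt_pow, rfl⟩ := Finset.mem_filter.mp hm
    obtain ⟨f, hf⟩ := exists_dbCost_representation m
    have hlt (i) : (f i).1 < n ∧ (f i).2 < n := by
      apply exponents_lt_of_two_pow_mul_three_pow_lt
      refine lt_of_le_of_lt ?_ (Finset.mem_range.mp hlt_pow)
      rw [← hf]
      exact Finset.single_le_sum (f := fun i => 2 ^ (f i).1 * 3 ^ (f i).2)
        (fun _ _ => Nat.zero_le _) (Finset.mem_univ i)
    exact Finset.mem_image.mpr
      ⟨fun i => (⟨(f i).1, (hlt i).1⟩, ⟨(f i).2, (hlt i).2⟩), Finset.mem_univ _, hf⟩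
  calc _ ≤ _ := Finset.card_le_card hsub
    _ ≤ _ := Finset.card_image_le
    _ = (n ^ 2) ^ k := by simp [pow_two]

/-- A Kraft-type inequality: spelling a minimal representation as `2 k` exponents followed by a
terminator, over an alphabet with `D > n` letters. -/
theorem sum_inv_pow_dbCost_le_one {n D : ℕ} (hD : n < D) :
    ∑ m ∈ Finset.range (2 ^ n), ((D : ℝ) ^ (2 * dbCost m + 1))⁻¹ ≤ 1 := by
  have hD' : (n : ℝ) + 1 ≤ D := by exact_mod_cast hD
  have hn : (0 : ℝ) ≤ n := n.cast_nonneg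
  have hD0 : (0 : ℝ) < D := by linarith
  have hq0 : 0 ≤ ((n : ℝ) / D) ^ 2 := by positivity
  have hq1 : ((n : ℝ) / D) ^ 2 < 1 :=
    pow_lt_one₀ (by positivity) ((div_lt_one hD0).mpr (by linarith)) (by norm_num)
  rw [Finset.sum_comp (fun k => ((D : ℝ) ^ (2 * k + 1))⁻¹) dbCost]
  calc _ ≤ ∑ k ∈ (Finset.range (2 ^ n)).image dbCost, (D : ℝ)⁻¹ * (((n : ℝ) / D) ^ 2) ^ k := by
        refine Finset.sum_le_sum fun k _ => ?_
        have hcard : (((Finset.range (2 ^ n)).filter fun m => dbCost m = k).card : ℝ) ≤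
            ((n : ℝ) ^ 2) ^ k := by
          exact_mod_cast card_filter_dbCost_eq_le n k
        rw [nsmul_eq_mul]
        refine (mul_le_mul_of_nonneg_right hcard (by positivity)).trans_eq ?_
        rw [div_pow, div_pow, pow_succ, ← pow_mul (D : ℝ)]
        field_simp
        ring
    _ = (D : ℝ)⁻¹ * ∑ k ∈ (Finset.range (2 ^ n)).image dbCost, (((n : ℝ) / D) ^ 2) ^ k := by
        rw [Finset.mul_sum]
    _ ≤ (D : ℝ)⁻¹ * (1 - ((n : ℝ) / D) ^ 2)⁻¹ := by
        rw [← tsum_geometric_of_lt_one hq0 hq1]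
        gcongr
        exact (summable_geometric_of_lt_one hq0 hq1).sum_le_tsum _ fun _ _ => by positivity
    _ ≤ 1 := by
        rw [← mul_inv]
        apply inv_le_one_of_one_le₀
        have h : (D : ℝ) * (1 - (n / D) ^ 2) = (D - n) * (D + n) / D := by
          field_simp
          ring
        rw [h, one_le_div hD0]
        nlinarith

/-- Over a binary alphabet, word lengths `ℓ` of `2 ^ n` symbols satisfying Kraft's inequality
average at least `n`. -/
theorem mul_two_pow_le_sum_of_kraft {n : ℕ} {ℓ : ℕ → ℕ}
    (h : ∑ m ∈ Finset.range (2 ^ n), ((2 : ℝ) ^ ℓ m)⁻¹ ≤ 1) :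
    (n : ℝ) * 2 ^ n ≤ ∑ m ∈ Finset.range (2 ^ n), (ℓ m : ℝ) := by
  have hlog (m) : ((n : ℝ) - ℓ m) * Real.log 2 ≤ 2 ^ n * ((2 : ℝ) ^ ℓ m)⁻¹ - 1 := by
    have := Real.log_le_sub_one_of_pos (x := 2 ^ n * ((2 : ℝ) ^ ℓ m)⁻¹) (by positivity)
    rwa [Real.log_mul (by positivity) (by positivity), Real.log_inv, Real.log_pow, Real.log_pow,
      ← sub_eq_add_neg, ← sub_mul] at this
  have hsum := Finset.sum_le_sum fun m (_ : m ∈ Finset.range (2 ^ n)) => hlog m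
  rw [← Finset.sum_mul, Finset.sum_sub_distrib, Finset.sum_sub_distrib, ← Finset.mul_sum] at hsum
  simp only [Finset.sum_const, Finset.card_range, nsmul_eq_mul, Nat.cast_pow, Nat.cast_ofNat,
    mul_one] at hsum
  have hkraft := mul_le_mul_of_nonneg_left h (by positivity : (0 : ℝ) ≤ 2 ^ n)
  have := nonpos_of_mul_nonpos_left (hsum.trans (by linarith)) (Real.log_pos one_lt_two)
  linarith

/-- For `n ≥ 2`, with `L = ⌈log₂ (n+1)⌉` and `A*(n)` the average of `k*` over
`{0, …, 2^n − 1}`, one has `(2 * A*(n) + 1) * L ≥ n`. -/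
theorem average_dbCost_explicit_bound (n : ℕ) (hn : 2 ≤ n) :
    (2 * ((∑ m ∈ Finset.range (2 ^ n), (dbCost m : ℝ)) / 2 ^ n) + 1) *
      (Nat.clog 2 (n + 1) : ℝ) ≥ n := by
  have hD : n < 2 ^ Nat.clog 2 (n + 1) := Nat.le_pow_clog one_lt_two (n + 1)
  have hkraft := sum_inv_pow_dbCost_le_one hD
  simp only [Nat.cast_pow, Nat.cast_ofNat, ← pow_mul] at hkraft
  have hsum := mul_two_pow_le_sum_of_kraft hkraft
  push_cast at hsum
  rw [← Finset.mul_sum, Finset.sum_add_distrib, ← Finset.mul_sum] at hsum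
  simp only [Finset.sum_const, Finset.card_range, nsmul_eq_mul, Nat.cast_pow, Nat.cast_ofNat,
    mul_one] at hsum
  refine le_of_mul_le_mul_right (hsum.trans_eq ?_) (by positivity : (0 : ℝ) < 2 ^ n)
  field_simp
end

section
/- Fix an integer q ≥ 1 and pairwise coprime integers b₁, …, b_q ≥ 2. For a non-negative integer m, let K*(m) denote the minimum k such that there exist non-negative integer exponents β_{i,1}, …, β_{i,q} (for i = 1, …, k) with Σ_{i=1}^k b₁^{β_{i,1}} ⋯ b_q^{β_{i,q}} = m. Then the average number of terms is Ω(n / log n): there exist c > 0 and N such that for all n ≥ N, (1/2^n) · Σ_{m=0}^{2^n − 1} K*(m) ≥ c · n / log₂ n. -/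
/-- Minimal number of terms in a multi-base representation of `m` with bases `b`. -/
noncomputable def multiCost (q : ℕ) (b : Fin q → ℕ) (m : ℕ) : ℕ :=
  sInf {k : ℕ | ∃ f : Fin k → Fin q → ℕ, ∑ i, ∏ j, (b j) ^ (f i j) = m}

/-- The minimum defining `multiCost` is attained. -/
theorem multiCost_spec (q : ℕ) (b : Fin q → ℕ) (m : ℕ) :
    ∃ f : Fin (multiCost q b m) → Fin q → ℕ, ∑ i, ∏ j, (b j) ^ (f i j) = m :=
  Nat.sInf_mem (s := {k : ℕ | ∃ f : Fin k → Fin q → ℕ, ∑ i, ∏ j, (b j) ^ (f i j) = m})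
    ⟨m, fun _ _ => 0, by simp⟩

/-- Every exponent of a product of powers of bases at least `2` is bounded by the
binary logarithm of that product. -/
theorem two_pow_le_prod_pow {q : ℕ} {b : Fin q → ℕ} (hb : ∀ j, 2 ≤ b j) (e : Fin q → ℕ)
    (j : Fin q) : 2 ^ e j ≤ ∏ i, b i ^ e i :=
  (Nat.pow_le_pow_left (hb j) _).trans <|
    Finset.single_le_prod' (f := fun i => b i ^ e i)
      (fun i _ => Nat.one_le_pow _ _ (by have := hb i; omega)) (Finset.mem_univ j)

/-- At most `(n ^ q + 1) ^ k` integers below `2 ^ n` have a representation with at most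
`k` terms. -/
theorem card_multiCost_le {q : ℕ} {b : Fin q → ℕ} (hb : ∀ j, 2 ≤ b j) (n k : ℕ) :
    ((Finset.range (2 ^ n)).filter (fun m => multiCost q b m ≤ k)).card
      ≤ (n ^ q + 1) ^ k := by
  classical
  let term : Option (Fin q → Fin n) → ℕ := fun o => o.elim 0 fun e => ∏ j, b j ^ (e j : ℕ)
  have hsub : (Finset.range (2 ^ n)).filter (fun m => multiCost q b m ≤ k) ⊆
      Finset.univ.image (fun g : Fin k → Option (Fin q → Fin n) => ∑ i, term (g i)) := by
    intro m hm
    obtain ⟨hmn, hmk⟩ := Finset.mem_filter.1 hm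
    obtain ⟨f, hf⟩ := multiCost_spec q b m
    obtain ⟨d, rfl⟩ := Nat.exists_eq_add_of_le hmk
    have hlt : ∀ i j, f i j < n := fun i j => by
      have hle : ∏ j, b j ^ f i j ≤ m := hf ▸
        Finset.single_le_sum (f := fun i => ∏ j, b j ^ f i j) (fun _ _ => Nat.zero_le _)
          (Finset.mem_univ i)
      exact (Nat.pow_lt_pow_iff_right Nat.one_lt_two).1
        (((two_pow_le_prod_pow hb (f i) j).trans hle).trans_lt (Finset.mem_range.1 hmn))
    refine Finset.mem_image.2
      ⟨Fin.append (fun i => some fun j => ⟨f i j, hlt i j⟩) (fun _ => none),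
        Finset.mem_univ _, ?_⟩
    rw [Fin.sum_univ_add]
    simpa [term] using hf
  refine (Finset.card_le_card hsub).trans (Finset.card_image_le.trans ?_)
  simp

/-- If at most half of the integers below `2 ^ n` have cost at most `k`, then the average
cost is at least `(k + 1) / 2`. -/
theorem half_le_average_multiCost {q : ℕ} {b : Fin q → ℕ} (n k : ℕ)
    (h : 2 * ((Finset.range (2 ^ n)).filter (fun m => multiCost q b m ≤ k)).card ≤ 2 ^ n) :
    ((k : ℝ) + 1) / 2 ≤ (∑ m ∈ Finset.range (2 ^ n), (multiCost q b m : ℝ)) / 2 ^ n := by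
  have hcard := Finset.card_filter_add_card_filter_not (s := Finset.range (2 ^ n))
    (fun m => multiCost q b m ≤ k)
  rw [Finset.card_range] at hcard
  set B := (Finset.range (2 ^ n)).filter (fun m => ¬ multiCost q b m ≤ k)
  have hB : 2 ^ n ≤ 2 * B.card := by omega
  have hsum : B.card * (k + 1) ≤ ∑ m ∈ Finset.range (2 ^ n), multiCost q b m := by
    rw [← smul_eq_mul]
    refine (Finset.card_nsmul_le_sum B _ _ fun m hm => ?_).trans
      (Finset.sum_le_sum_of_subset (Finset.filter_subset _ _))
    exact Nat.lt_of_not_le (Finset.mem_filter.1 hm).2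
  have hB' : (2 : ℝ) ^ n ≤ 2 * B.card := by exact_mod_cast hB
  have hsum' : (B.card : ℝ) * (k + 1) ≤ ∑ m ∈ Finset.range (2 ^ n), (multiCost q b m : ℝ) := by
    exact_mod_cast hsum
  rw [le_div_iff₀ (by positivity)]
  nlinarith [mul_le_mul_of_nonneg_right hB' (by positivity : (0 : ℝ) ≤ (k : ℝ) + 1)]

/-- For pairwise coprime bases `b₁, …, b_q ≥ 2`, the average minimal number of terms
over `{0, …, 2^n − 1}` is `Ω(n / log₂ n)`. -/
theorem average_multiCost_lower_bound (q : ℕ) (hq : 1 ≤ q)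
    (b : Fin q → ℕ) (hb : ∀ j, 2 ≤ b j)
    (hcop : ∀ i j : Fin q, i ≠ j → Nat.Coprime (b i) (b j)) :
    ∃ c : ℝ, 0 < c ∧ ∃ N : ℕ, ∀ n : ℕ, N ≤ n →
      (∑ m ∈ Finset.range (2 ^ n), (multiCost q b m : ℝ)) / 2 ^ n
        ≥ c * n / Real.logb 2 n := by
  refine ⟨1 / (4 * (q + 1)), by positivity, 2, fun n hn => ?_⟩
  have hn' : (2 : ℝ) ≤ n := by exact_mod_cast hn
  have hL : 0 < Real.logb 2 n := Real.logb_pos (by norm_num) (by linarith)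
  set L := Real.logb 2 n
  set x : ℝ := (n - 1) / ((q + 1) * L)
  have hx : 0 ≤ x := div_nonneg (by linarith) (by positivity)
  set k := ⌊x⌋₊
  have hkL : (q + 1) * k * L ≤ n - 1 := by
    have := (le_div_iff₀ (by positivity)).1 (Nat.floor_le hx)
    linarith
  have hpow : n ^ ((q + 1) * k) ≤ 2 ^ (n - 1) := by
    have hreal : (n : ℝ) ^ ((q + 1) * k) ≤ 2 ^ (n - 1) := by
      rw [← Real.logb_le_logb (b := 2) (by norm_num) (by positivity) (by positivity),
        Real.logb_pow, Real.logb_pow, Real.logb_self_eq_one (by norm_num)]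
      push_cast [Nat.cast_sub (show 1 ≤ n by omega)]
      linarith
    exact_mod_cast hreal
  have hterms : n ^ q + 1 ≤ n ^ (q + 1) := by
    have := Nat.one_le_pow q n (by omega)
    rw [pow_succ]
    nlinarith
  have hcard := calc
    ((Finset.range (2 ^ n)).filter (fun m => multiCost q b m ≤ k)).card
      ≤ (n ^ q + 1) ^ k := card_multiCost_le hb n k
    _ ≤ (n ^ (q + 1)) ^ k := Nat.pow_le_pow_left hterms k
    _ = n ^ ((q + 1) * k) := (pow_mul _ _ _).symm
    _ ≤ 2 ^ (n - 1) := hpow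
  have htwo : 2 ^ n = 2 * 2 ^ (n - 1) := by
    rw [← pow_succ', Nat.sub_add_cancel (by omega)]
  refine ge_iff_le.2 (le_trans ?_ (half_le_average_multiCost n k (by omega)))
  have hxk : x < k + 1 := Nat.lt_floor_add_one x
  have hbound : 1 / (4 * (q + 1)) * n / L ≤ x / 2 := by
    simp only [x]
    rw [div_div, div_mul_eq_mul_div, div_div, div_le_div_iff₀ (by positivity) (by positivity)]
    have : 0 < ((q : ℝ) + 1) * L := by positivity
    nlinarith
  linarith
end

section
/- Fix a finite set D of nonzero integers and a constant C > 0. There exist c > 0 and N such that for all n ≥ N the following holds: for every family of signed-digit double-base representations, one for each m ∈ {0, …, 2^n − 1}, of the form m = Σ_{i=1}^{k_m} d_{m,i} · 2^{x_{m,i}} · 3^{y_{m,i}} with all digits d_{m,i} ∈ D and all exponents x_{m,i}, y_{m,i} ≤ C · log₂ n, the average number of terms satisfies (1/2^n) · Σ_{m=0}^{2^n − 1} k_m ≥ c · n / log₂ n. -/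
open Finset in
/-- At most `#S ^ K` naturals are sums of at most `K` elements of a finite set `S ∋ 0`. -/
lemma card_filter_short_sums_le (S : Finset ℤ) (h0 : 0 ∈ S) (K M : ℕ) (k : ℕ → ℕ)
    (f : (m : ℕ) → Fin (k m) → ℤ) (hS : ∀ m < M, ∀ i, f m i ∈ S)
    (hsum : ∀ m < M, ∑ i, f m i = (m : ℤ)) :
    #{m ∈ range M | k m ≤ K} ≤ #S ^ K := by
  have hcard : #((Fintype.piFinset fun _ : Fin K => S).image fun g => ∑ i, g i) ≤ #S ^ K := by
    refine card_image_le.trans ?_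
    simp
  refine le_trans (card_le_card_of_injOn (fun m : ℕ => (m : ℤ)) ?_ Nat.cast_injective.injOn) hcard
  intro m hm
  simp only [coe_filter, mem_range, Set.mem_ofPred_eq] at hm
  obtain ⟨hmM, hmK⟩ := hm
  obtain ⟨t, rfl⟩ := Nat.exists_eq_add_of_le hmK
  simp only [coe_image, Set.mem_image, mem_coe, Fintype.mem_piFinset]
  refine ⟨Fin.append (f m) fun _ => 0, fun i => ?_, ?_⟩
  · refine Fin.addCases (fun j => ?_) (fun j => ?_) i
    · simpa using hS m hmM j
    · simpa using h0
  · simp [Fin.sum_univ_add, hsum m hmM]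

open Filter in
/-- Any multiple of a squared binary logarithm is eventually below the identity. -/
lemma eventually_mul_logb_sq_le (A : ℝ) (hA : 0 < A) :
    ∀ᶠ n : ℕ in atTop, A * Real.logb 2 n ^ 2 ≤ n := by
  have hl : 0 < Real.log 2 := Real.log_pos one_lt_two
  have h := (Real.isLittleO_pow_log_id_atTop (n := 2)).bound
    (show 0 < Real.log 2 ^ 2 / A by positivity)
  filter_upwards [tendsto_natCast_atTop_atTop.eventually h] with n hn
  simp only [id, Real.norm_eq_abs, abs_pow, sq_abs, Nat.abs_cast] at hn
  rw [Real.logb, div_pow, ← mul_div_assoc, div_le_iff₀ (by positivity)]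
  calc A * Real.log n ^ 2 ≤ A * (Real.log 2 ^ 2 / A * n) := by gcongr
    _ = n * Real.log 2 ^ 2 := by field_simp

open Finset in
/-- The values of single double-base terms with exponents at most `B`, together with `0`. -/
def doubleBaseTerms (D : Finset ℤ) (B : ℕ) : Finset ℤ :=
  insert 0 ((D ×ˢ range (B + 1) ×ˢ range (B + 1)).image fun p => p.1 * 2 ^ p.2.1 * 3 ^ p.2.2)

open Finset in
lemma card_doubleBaseTerms_le (D : Finset ℤ) (B : ℕ) :
    #(doubleBaseTerms D B) ≤ #D * (B + 1) ^ 2 + 1 := by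
  refine (card_insert_le _ _).trans (Nat.add_le_add_right (card_image_le.trans ?_) 1)
  simp [sq]

open Finset in
lemma mem_doubleBaseTerms {D : Finset ℤ} {B x y : ℕ} {d : ℤ} (hd : d ∈ D) (hx : x ≤ B)
    (hy : y ≤ B) : d * 2 ^ x * 3 ^ y ∈ doubleBaseTerms D B := by
  refine mem_insert_of_mem (mem_image.2 ⟨(d, x, y), ?_, rfl⟩)
  simp only [mem_product, mem_range]
  exact ⟨hd, by omega, by omega⟩

open Finset in
/-- If at most half of the values of `k` on `range M` are at most `K`, their sum is at least
`(K + 1) * M / 2`. -/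
lemma mul_half_le_sum_of_card_filter_le (M K : ℕ) (k : ℕ → ℕ)
    (h : 2 * #{m ∈ range M | k m ≤ K} ≤ M) :
    (K + 1) * M ≤ 2 * ∑ m ∈ range M, k m := by
  have hsplit := card_filter_add_card_filter_not (s := range M) (fun m => k m ≤ K)
  rw [card_range] at hsplit
  have hlow : #{m ∈ range M | ¬ k m ≤ K} * (K + 1) ≤ ∑ m ∈ range M, k m :=
    calc _ ≤ ∑ m ∈ range M with ¬ k m ≤ K, k m := by
          rw [← smul_eq_mul]
          refine card_nsmul_le_sum _ _ _ fun m hm => ?_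
          have := (mem_filter.1 hm).2
          omega
      _ ≤ _ := sum_le_sum_of_subset (filter_subset _ _)
  have hhalf : M ≤ 2 * #{m ∈ range M | ¬ k m ≤ K} := by omega
  nlinarith


/-- For a fixed finite digit set `D` of nonzero integers and constant `C > 0`, any family of
signed-digit double-base representations of all `m ∈ {0, …, 2^n − 1}` with exponents bounded
by `C · log₂ n` has average number of terms at least `c · n / log₂ n` for large `n`. -/
theorem average_signed_digit_lower_bound (D : Finset ℤ) (hD : 0 ∉ D) (C : ℝ) (hC : 0 < C) :
    ∃ c : ℝ, 0 < c ∧ ∃ N : ℕ, ∀ n : ℕ, N ≤ n →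
      ∀ (k : ℕ → ℕ) (d : (m : ℕ) → Fin (k m) → ℤ) (x y : (m : ℕ) → Fin (k m) → ℕ),
        (∀ m : ℕ, m < 2 ^ n →
          (∀ i, d m i ∈ D) ∧
          (∀ i, (x m i : ℝ) ≤ C * Real.logb 2 n ∧ (y m i : ℝ) ≤ C * Real.logb 2 n) ∧
          (∑ i, d m i * 2 ^ (x m i) * 3 ^ (y m i)) = (m : ℤ)) →
        (∑ m ∈ Finset.range (2 ^ n), (k m : ℝ)) / 2 ^ n ≥ c * n / Real.logb 2 n := by
  refine ⟨1 / 4, by norm_num, ?_⟩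
  obtain ⟨N, hN⟩ := Filter.eventually_atTop.1
    (eventually_mul_logb_sq_le (D.card * (C + 1) ^ 2 + 1) (by positivity))
  refine ⟨max N 2, fun n hn k d x y h => ?_⟩
  have hn2 : 2 ≤ n := (le_max_right _ _).trans hn
  have hn2' : (2 : ℝ) ≤ n := by exact_mod_cast hn2
  have hlog := hN n ((le_max_left _ _).trans hn)
  set L := Real.logb 2 n with hL
  have hL1 : 1 ≤ L := by
    rw [hL, Real.le_logb_iff_rpow_le one_lt_two (by linarith)]
    simpa using hn2'
  have hL0 : 0 < L := by linarith
  have hCL : 0 ≤ C * L := by positivity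
  set B := ⌊C * L⌋₊
  have hB : (B : ℝ) + 1 ≤ (C + 1) * L := by
    have : (B : ℝ) ≤ C * L := Nat.floor_le hCL
    linarith
  have hcard : (doubleBaseTerms D B).card ≤ n := by
    refine (card_doubleBaseTerms_le D B).trans ?_
    have : (D.card : ℝ) * (B + 1) ^ 2 + 1 ≤ n :=
      calc (D.card : ℝ) * (B + 1) ^ 2 + 1 ≤ D.card * ((C + 1) * L) ^ 2 + L ^ 2 := by
            gcongr
            exact one_le_pow₀ hL1
        _ = (D.card * (C + 1) ^ 2 + 1) * L ^ 2 := by ring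
        _ ≤ n := hlog
    exact_mod_cast this
  set K := ⌊((n : ℝ) - 1) / L⌋₊
  have hK : (K : ℝ) * L ≤ n - 1 := by
    rw [← le_div_iff₀ hL0]
    exact Nat.floor_le (div_nonneg (by linarith) hL0.le)
  have hK' : ((n : ℝ) - 1) / L ≤ K + 1 := (Nat.lt_floor_add_one _).le
  have hpow : 2 * n ^ K ≤ 2 ^ n := by
    have hnL : (n : ℝ) = 2 ^ L := (Real.rpow_logb two_pos (by norm_num) (by linarith)).symm
    have : (2 : ℝ) * (n : ℝ) ^ K ≤ 2 ^ n :=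
      calc (2 : ℝ) * (n : ℝ) ^ K = 2 ^ (1 + K * L) := by
            rw [Real.rpow_add two_pos, Real.rpow_one, mul_comm (K : ℝ) L,
              Real.rpow_mul zero_le_two, ← hnL, Real.rpow_natCast]
        _ ≤ 2 ^ (n : ℝ) := Real.rpow_le_rpow_of_exponent_le one_le_two (by linarith)
        _ = 2 ^ n := Real.rpow_natCast _ _
    exact_mod_cast this
  have hshort := card_filter_short_sums_le (doubleBaseTerms D B) (Finset.mem_insert_self _ _)
    K (2 ^ n) k (fun m i => d m i * 2 ^ x m i * 3 ^ y m i)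
    (fun m hm i => mem_doubleBaseTerms ((h m hm).1 i) (Nat.le_floor ((h m hm).2.1 i).1)
      (Nat.le_floor ((h m hm).2.1 i).2))
    (fun m hm => (h m hm).2.2)
  have hsum := mul_half_le_sum_of_card_filter_le (2 ^ n) K k (le_trans (by
    gcongr
    exact hshort.trans (Nat.pow_le_pow_left hcard K)) hpow)
  have hsum' : ((K : ℝ) + 1) * 2 ^ n ≤ 2 * ∑ m ∈ Finset.range (2 ^ n), (k m : ℝ) := by
    exact_mod_cast hsum
  rw [ge_iff_le, le_div_iff₀ (by positivity)]
  have hquarter : 1 / 4 * (n : ℝ) / L ≤ (K + 1) / 2 :=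
    calc 1 / 4 * (n : ℝ) / L ≤ (((n : ℝ) - 1) / 2) / L := by
          gcongr
          linarith
      _ = ((n : ℝ) - 1) / L / 2 := by ring
      _ ≤ (K + 1) / 2 := by gcongr
  calc 1 / 4 * (n : ℝ) / L * 2 ^ n ≤ (K + 1) / 2 * 2 ^ n := by gcongr
    _ ≤ ∑ m ∈ Finset.range (2 ^ n), (k m : ℝ) := by linarith
end
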